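/- Let n_{3,2} = V ⊕ ℝ^5 be a pseudo H-type Lie algebra built on a minimal admissible Cl_{3,2}-module V, and let n_{2,3} = V' ⊕ ℝ^5 be a pseudo H-type Lie algebra built on a minimal admissible Cl_{2,3}-module V'. Then for X ∈ V the linear map ad_X = [X,·] : V → ℝ^5 is surjective if and only if ⟨X,X⟩_V ≠ 0, and likewise for X ∈ V' the map ad_X : V' → ℝ^5 is surjective if and only if ⟨X,X⟩_{V'} ≠ 0. -/

import Mathlib

/-- The standard scalar product of signature `(r,s)` on `ℝ^(r+s)`:
`⟨Z,W⟩_{r,s} = ∑_{i<r} Z i * W i - ∑_{r ≤ i < r+s} Z i * W i`. -/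
def sform (r s : ℕ) (Z W : Fin (r + s) → ℝ) : ℝ :=
  ∑ i : Fin (r + s), (if (i : ℕ) < r then (1 : ℝ) else -1) * Z i * W i

/-- `(V, B, J)` is an admissible module of the Clifford algebra `Cl_{r,s}`:
`V` is a nonzero finite-dimensional real vector space, `B` a nondegenerate
symmetric bilinear form on `V`, and `J : ℝ^{r+s} → End V` linear with
`J_Z ∘ J_Z = -⟨Z,Z⟩_{r,s} • id` and each `J_Z` skew-adjoint w.r.t. `B`. -/
def IsAdmissible (r s : ℕ) (V : Type) [AddCommGroup V] [Module ℝ V]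
    (B : V →ₗ[ℝ] V →ₗ[ℝ] ℝ)
    (J : (Fin (r + s) → ℝ) →ₗ[ℝ] V →ₗ[ℝ] V) : Prop :=
  FiniteDimensional ℝ V ∧ Nontrivial V ∧
  (∀ v w : V, B v w = B w v) ∧
  (∀ v : V, (∀ w : V, B v w = 0) → v = 0) ∧
  (∀ (Z : Fin (r + s) → ℝ) (v : V), J Z (J Z v) = (-(sform r s Z Z)) • v) ∧
  (∀ (Z : Fin (r + s) → ℝ) (v w : V), B (J Z v) w = -(B v (J Z w)))

/-- A minimal admissible `Cl_{r,s}`-module: one of least possible dimension. -/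
def IsMinimalAdmissible (r s : ℕ) (V : Type) [AddCommGroup V] [Module ℝ V]
    (B : V →ₗ[ℝ] V →ₗ[ℝ] ℝ)
    (J : (Fin (r + s) → ℝ) →ₗ[ℝ] V →ₗ[ℝ] V) : Prop :=
  IsAdmissible r s V B J ∧
  ∀ (V' : Type) [AddCommGroup V'] [Module ℝ V']
    (B' : V' →ₗ[ℝ] V' →ₗ[ℝ] ℝ)
    (J' : (Fin (r + s) → ℝ) →ₗ[ℝ] V' →ₗ[ℝ] V'),
    IsAdmissible r s V' B' J' → Module.finrank ℝ V ≤ Module.finrank ℝ V'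

/-- `br` is the Lie bracket of the pseudo `H`-type Lie algebra `V ⊕ ℝ^{r+s}`
determined by the admissible module `(V,B,J)`, i.e.
`⟨Z, [v,w]⟩_{r,s} = ⟨J_Z v, w⟩_V` for all `Z, v, w`. -/
def IsHBracket (r s : ℕ) (V : Type) [AddCommGroup V] [Module ℝ V]
    (B : V →ₗ[ℝ] V →ₗ[ℝ] ℝ)
    (J : (Fin (r + s) → ℝ) →ₗ[ℝ] V →ₗ[ℝ] V)
    (br : V →ₗ[ℝ] V →ₗ[ℝ] (Fin (r + s) → ℝ)) : Prop :=
  ∀ (Z : Fin (r + s) → ℝ) (v w : V), sform r s Z (br v w) = B (J Z v) w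

/-- A linear equivalence `f` between the pseudo `H`-type Lie algebras
`V₁ ⊕ ℝ^{n₁}` and `V₂ ⊕ ℝ^{n₂}` (with 2-step brackets `br₁`, `br₂`, the
`ℝ^{nᵢ}` factors being central) is a Lie algebra isomorphism. -/
def IsLieIso {V₁ : Type} [AddCommGroup V₁] [Module ℝ V₁]
    {V₂ : Type} [AddCommGroup V₂] [Module ℝ V₂] {n₁ n₂ : ℕ}
    (br₁ : V₁ →ₗ[ℝ] V₁ →ₗ[ℝ] (Fin n₁ → ℝ))
    (br₂ : V₂ →ₗ[ℝ] V₂ →ₗ[ℝ] (Fin n₂ → ℝ))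
    (f : (V₁ × (Fin n₁ → ℝ)) ≃ₗ[ℝ] (V₂ × (Fin n₂ → ℝ))) : Prop :=
  ∀ x y : V₁ × (Fin n₁ → ℝ),
    f (0, br₁ x.1 y.1) = (0, br₂ (f x).1 (f y).1)

lemma sform_add_self (r s : ℕ) (Z W : Fin (r + s) → ℝ) :
    sform r s (Z + W) (Z + W) = sform r s Z Z + 2 * sform r s Z W + sform r s W W := by
  simp only [sform, Finset.mul_sum, ← Finset.sum_add_distrib, Pi.add_apply]
  exact Finset.sum_congr rfl fun i _ => by ring

lemma sform_comm (r s : ℕ) (Z W : Fin (r + s) → ℝ) : sform r s Z W = sform r s W Z :=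
  Finset.sum_congr rfl fun i _ => by ring

lemma sform_smul_right (r s : ℕ) (c : ℝ) (Z W : Fin (r + s) → ℝ) :
    sform r s Z (c • W) = sform r s Z W * c := by
  simp only [sform, Finset.sum_mul, Pi.smul_apply, smul_eq_mul]
  exact Finset.sum_congr rfl fun i _ => by ring

lemma sform_sub_right (r s : ℕ) (Z W W' : Fin (r + s) → ℝ) :
    sform r s Z (W - W') = sform r s Z W - sform r s Z W' := by
  simp only [sform, ← Finset.sum_sub_distrib, Pi.sub_apply]
  exact Finset.sum_congr rfl fun i _ => by ring

lemma eq_zero_of_sform_right {r s : ℕ} {Z : Fin (r + s) → ℝ}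
    (h : ∀ W, sform r s Z W = 0) : Z = 0 := by
  funext i
  have hi := h (Pi.single i 1)
  simp only [sform, Pi.single_apply, mul_ite, mul_one, mul_zero, Finset.sum_ite_eq',
    Finset.mem_univ, if_true] at hi
  split_ifs at hi <;> simpa using hi

section Admissible

variable {r s : ℕ} {V : Type} [AddCommGroup V] [Module ℝ V] {B : V →ₗ[ℝ] V →ₗ[ℝ] ℝ}
  {J : (Fin (r + s) → ℝ) →ₗ[ℝ] V →ₗ[ℝ] V} {br : V →ₗ[ℝ] V →ₗ[ℝ] (Fin (r + s) → ℝ)}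

/-- Clifford multiplication scales the form: `⟨J_Z X, J_W X⟩ = ⟨Z, W⟩ ⟨X, X⟩`. -/
lemma IsAdmissible.form_clifford (h : IsAdmissible r s V B J) (Z W : Fin (r + s) → ℝ) (X : V) :
    B (J Z X) (J W X) = sform r s Z W * B X X := by
  obtain ⟨-, -, hsymm, -, hsq, hskew⟩ := h
  have hdiag (Z : Fin (r + s) → ℝ) : B (J Z X) (J Z X) = sform r s Z Z * B X X := by
    rw [hskew, hsq]; simp
  have hsum := hdiag (Z + W)
  rw [sform_add_self] at hsum
  simp only [map_add, LinearMap.add_apply] at hsum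
  linarith [hdiag Z, hdiag W, hsymm (J Z X) (J W X)]

lemma IsHBracket.bracket_clifford (h : IsAdmissible r s V B J) (hbr : IsHBracket r s V B J br)
    (W : Fin (r + s) → ℝ) (X : V) : br X (J W X) = B X X • W := by
  refine sub_eq_zero.mp (eq_zero_of_sform_right fun Z => ?_)
  rw [sform_comm, sform_sub_right, hbr, h.form_clifford, sform_smul_right, sub_self]

lemma IsHBracket.clifford_injective (hbr : IsHBracket r s V B J br) {X : V}
    (hX : Function.Surjective (br X)) : Function.Injective (J.flip X) := by
  refine (injective_iff_map_eq_zero _).mpr fun Z hZ => eq_zero_of_sform_right fun W => ?_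
  obtain ⟨w, rfl⟩ := hX W
  rw [LinearMap.flip_apply] at hZ
  rw [hbr, hZ, map_zero, LinearMap.zero_apply]

/-- Over an admissible module of dimension less than `2 (r + s)`, the map `ad_X` is surjective
exactly when `X` is not null. -/
theorem IsHBracket.surjective_iff (h : IsAdmissible r s V B J) (hbr : IsHBracket r s V B J br)
    (hdim : Module.finrank ℝ V < 2 * (r + s)) (X : V) :
    Function.Surjective (br X) ↔ B X X ≠ 0 := by
  constructor
  · intro hsurj hnull
    have := h.1
    have hle : LinearMap.range (J.flip X) ≤ LinearMap.ker (br X) := by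
      rintro _ ⟨W, rfl⟩
      rw [LinearMap.mem_ker, LinearMap.flip_apply, hbr.bracket_clifford h, hnull, zero_smul]
    have hker := Submodule.finrank_mono hle
    have hrank := LinearMap.finrank_range_add_finrank_ker (br X)
    rw [LinearMap.finrank_range_of_inj (hbr.clifford_injective hsurj)] at hker
    rw [LinearMap.range_eq_top.mpr hsurj, finrank_top] at hrank
    simp only [Module.finrank_fin_fun] at hker hrank
    omega
  · intro hX W
    refine ⟨J ((B X X)⁻¹ • W) X, ?_⟩
    rw [hbr.bracket_clifford h, smul_inv_smul₀ hX]

end Admissible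

/-- Pairs of real `2 × 2` matrices. -/
abbrev MatrixPair : Type := Matrix (Fin 2) (Fin 2) ℝ × Matrix (Fin 2) (Fin 2) ℝ

/-- The sum of the polarized determinants, `tr (X adj X') + tr (Y adj Y')`. -/
def matrixPairForm : MatrixPair →ₗ[ℝ] MatrixPair →ₗ[ℝ] ℝ :=
  LinearMap.mk₂ ℝ (fun v w =>
      v.1 0 0 * w.1 1 1 - v.1 0 1 * w.1 1 0 - v.1 1 0 * w.1 0 1 + v.1 1 1 * w.1 0 0
      + (v.2 0 0 * w.2 1 1 - v.2 0 1 * w.2 1 0 - v.2 1 0 * w.2 0 1 + v.2 1 1 * w.2 0 0))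
    (fun _ _ _ => by simp; ring) (fun _ _ _ => by simp; ring)
    (fun _ _ _ => by simp; ring) (fun _ _ _ => by simp; ring)

/-- The Clifford action `(X, Y) ↦ (A Y + X C, -(adj A) X - Y C)`, where `C` is traceless; it squares
to `-(det A + det C)`. The sign of `det C` is opposite to that of `ε`. -/
def matrixPairClifford (ε : ℝ) : (Fin 5 → ℝ) →ₗ[ℝ] MatrixPair →ₗ[ℝ] MatrixPair :=
  LinearMap.mk₂ ℝ (fun Z v =>
      (!![Z 0 + Z 3, Z 1 + Z 4; Z 4 - Z 1, Z 0 - Z 3] * v.2 + v.1 * !![0, Z 2; ε * Z 2, 0],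
        -(!![Z 0 - Z 3, -(Z 1 + Z 4); -(Z 4 - Z 1), Z 0 + Z 3] * v.1)
          - v.2 * !![0, Z 2; ε * Z 2, 0]))
    (fun _ _ _ => by
      ext i j <;> fin_cases i <;> fin_cases j <;>
        simp [Matrix.mul_apply, Matrix.vecMul, dotProduct] <;> ring)
    (fun _ _ _ => by
      ext i j <;> fin_cases i <;> fin_cases j <;>
        simp [Matrix.mul_apply, Matrix.vecMul, dotProduct] <;> ring)
    (fun _ _ _ => by
      ext i j <;> fin_cases i <;> fin_cases j <;>
        simp [Matrix.mul_apply, Matrix.vecMul, dotProduct] <;> ring)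
    (fun _ _ _ => by
      ext i j <;> fin_cases i <;> fin_cases j <;>
        simp [Matrix.mul_apply, Matrix.vecMul, dotProduct] <;> ring)

lemma matrixPairForm_comm (v w : MatrixPair) : matrixPairForm v w = matrixPairForm w v := by
  simp only [matrixPairForm, LinearMap.mk₂_apply]; ring

lemma eq_zero_of_matrixPairForm {v : MatrixPair} (h : ∀ w, matrixPairForm v w = 0) : v = 0 := by
  have h₁ (M : Matrix (Fin 2) (Fin 2) ℝ) := h (M, 0)
  have h₂ (M : Matrix (Fin 2) (Fin 2) ℝ) := h (0, M)
  simp only [matrixPairForm, LinearMap.mk₂_apply, Matrix.zero_apply] at h₁ h₂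
  ext i j <;> fin_cases i <;> fin_cases j
  · simpa using h₁ !![0, 0; 0, 1]
  · simpa using h₁ !![0, 0; 1, 0]
  · simpa using h₁ !![0, 1; 0, 0]
  · simpa using h₁ !![1, 0; 0, 0]
  · simpa using h₂ !![0, 0; 0, 1]
  · simpa using h₂ !![0, 0; 1, 0]
  · simpa using h₂ !![0, 1; 0, 0]
  · simpa using h₂ !![1, 0; 0, 0]

lemma matrixPairClifford_sq (ε : ℝ) (Z : Fin 5 → ℝ) (v : MatrixPair) :
    matrixPairClifford ε Z (matrixPairClifford ε Z v) =
      (-(Z 0 ^ 2 + Z 1 ^ 2 - ε * Z 2 ^ 2 - Z 3 ^ 2 - Z 4 ^ 2)) • v := by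
  ext i j <;> fin_cases i <;> fin_cases j <;>
    simp [matrixPairClifford, Matrix.mul_apply, Matrix.vecMul, dotProduct] <;> ring

lemma matrixPairClifford_skew (ε : ℝ) (Z : Fin 5 → ℝ) (v w : MatrixPair) :
    matrixPairForm (matrixPairClifford ε Z v) w =
      -(matrixPairForm v (matrixPairClifford ε Z w)) := by
  simp [matrixPairForm, matrixPairClifford, Matrix.mul_apply, Matrix.vecMul, dotProduct]; ring

lemma isAdmissible_matrixPair_three_two :
    IsAdmissible 3 2 MatrixPair matrixPairForm (matrixPairClifford (-1)) := by
  refine ⟨inferInstance, inferInstance, matrixPairForm_comm, fun _ => eq_zero_of_matrixPairForm,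
    fun Z v => ?_, matrixPairClifford_skew _⟩
  rw [matrixPairClifford_sq]
  congr 2
  simp [sform, Fin.sum_univ_five]
  ring

lemma isAdmissible_matrixPair_two_three :
    IsAdmissible 2 3 MatrixPair matrixPairForm (matrixPairClifford 1) := by
  refine ⟨inferInstance, inferInstance, matrixPairForm_comm, fun _ => eq_zero_of_matrixPairForm,
    fun Z v => ?_, matrixPairClifford_skew _⟩
  rw [matrixPairClifford_sq]
  congr 2
  simp [sform, Fin.sum_univ_five]
  ring

lemma finrank_matrixPair : Module.finrank ℝ MatrixPair = 8 := by
  simp [Module.finrank_matrix]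

theorem stmt13
    (V1 : Type) [AddCommGroup V1] [Module ℝ V1]
    (B1 : V1 →ₗ[ℝ] V1 →ₗ[ℝ] ℝ)
    (J1 : (Fin (3 + 2) → ℝ) →ₗ[ℝ] V1 →ₗ[ℝ] V1)
    (br1 : V1 →ₗ[ℝ] V1 →ₗ[ℝ] (Fin (3 + 2) → ℝ))
    (hadm1 : IsMinimalAdmissible 3 2 V1 B1 J1)
    (hbr1 : IsHBracket 3 2 V1 B1 J1 br1)
    (V2 : Type) [AddCommGroup V2] [Module ℝ V2]
    (B2 : V2 →ₗ[ℝ] V2 →ₗ[ℝ] ℝ)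
    (J2 : (Fin (2 + 3) → ℝ) →ₗ[ℝ] V2 →ₗ[ℝ] V2)
    (br2 : V2 →ₗ[ℝ] V2 →ₗ[ℝ] (Fin (2 + 3) → ℝ))
    (hadm2 : IsMinimalAdmissible 2 3 V2 B2 J2)
    (hbr2 : IsHBracket 2 3 V2 B2 J2 br2)
    :
    (∀ X : V1, Function.Surjective ⇑(br1 X) ↔ B1 X X ≠ 0) ∧
    (∀ X : V2, Function.Surjective ⇑(br2 X) ↔ B2 X X ≠ 0) := by
  have hdim₁ := hadm1.2 _ _ _ isAdmissible_matrixPair_three_two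
  have hdim₂ := hadm2.2 _ _ _ isAdmissible_matrixPair_two_three
  rw [finrank_matrixPair] at hdim₁ hdim₂
  exact ⟨hbr1.surjective_iff hadm1.1 (by omega), hbr2.surjective_iff hadm2.1 (by omega)⟩
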